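/- arXiv:1312.7192 — 2 statements merged into one kernel-verified Lean document; each statement's English description precedes it below -/
import Mathlib

section
/- Let S be a finite inverse semigroup and let s, t ∈ S. If s is not a lonely idempotent or t is not a lonely idempotent, then the product s·t is not a lonely idempotent. -/
/-- An inverse semigroup: a nonempty semigroup in which every element `x` has a
unique element `y` with `x*y*x = x` and `y*x*y = y`; this `y` is `inv x`. -/
class InverseSemigroup (S : Type*) extends Semigroup S where
  nonempty : Nonempty S
  inv : S → S
  mul_inv_mul : ∀ x : S, x * inv x * x = x
  inv_mul_inv : ∀ x : S, inv x * x * inv x = inv x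
  inv_unique : ∀ x y : S, x * y * x = x → y * x * y = y → y = inv x

namespace InverseSemigroup

variable {S : Type*}

/-- The natural partial order: `s ≤ t` iff `s = e * t` for some idempotent `e`. -/
def nle [InverseSemigroup S] (s t : S) : Prop := ∃ e : S, e * e = e ∧ s = e * t

/-- Strict version of the natural partial order. -/
def nlt [InverseSemigroup S] (s t : S) : Prop := nle s t ∧ s ≠ t

/-- Green's D-relation: `s D t` iff there is `z` with `z⁻¹z = t⁻¹t` and `zz⁻¹ = ss⁻¹`. -/
def dRel [InverseSemigroup S] (s t : S) : Prop :=
  ∃ z : S, inv z * z = inv t * t ∧ z * inv z = s * inv s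

/-- `m` is the minimum element of the semilattice of idempotents `(E(S), ≤)`. -/
def IsMinIdem [InverseSemigroup S] (m : S) : Prop :=
  m * m = m ∧ ∀ f : S, f * f = f → nle m f

/-- `e` is a lonely idempotent (relative to the minimum idempotent `m`):
`G_e = {e}`, `{e}` is a D-class, `e` covers `m` in `E(S)`, and `e` is not
covered by any idempotent. -/
def Lonely [InverseSemigroup S] (m e : S) : Prop :=
  e * e = e ∧
  (∀ s : S, s * inv s = e → inv s * s = e → s = e) ∧
  (∀ s : S, dRel s e → s = e) ∧
  nlt m e ∧ (¬ ∃ h : S, h * h = h ∧ nlt m h ∧ nlt h e) ∧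
  ¬ ∃ h : S, h * h = h ∧ nlt e h ∧ ¬ ∃ h' : S, h' * h' = h' ∧ nlt e h' ∧ nlt h' h

end InverseSemigroup

open InverseSemigroup

namespace InverseSemigroup

variable {S : Type*} [InverseSemigroup S]

theorem inv_eq_self_of_idem {e : S} (he : e * e = e) : inv e = e :=
  (inv_unique e e (by rw [he, he]) (by rw [he, he])).symm

theorem mul_inv_idem (s : S) : s * inv s * (s * inv s) = s * inv s := by
  rw [← mul_assoc, mul_inv_mul]

theorem inv_mul_idem (s : S) : inv s * s * (inv s * s) = inv s * s := by
  rw [← mul_assoc, inv_mul_inv]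

theorem mul_eq_left_of_nle {a b : S} (hb : b * b = b) (h : nle a b) : a * b = a := by
  obtain ⟨f, -, rfl⟩ := h
  rw [mul_assoc, hb]

theorem idem_antisymm {a b : S} (ha : a * a = a) (hb : b * b = b)
    (hab : a * b = a) (hba : b * a = b) : a = b := by
  have h := inv_unique a b (by rw [hab, ha]) (by rw [hba, hb])
  rw [h, inv_eq_self_of_idem ha]

theorem idem_mul_eq_left {e g : S} (he : e * e = e) (h : g * e = e) : e * g = e := by
  have h' := inv_unique e (e * g)
    (by rw [← mul_assoc, he, mul_assoc, h, he])
    (by rw [mul_assoc e g e, h, he, ← mul_assoc, he])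
  rw [h', inv_eq_self_of_idem he]

/-- In a finite inverse semigroup, an idempotent not covered by any idempotent is maximal. -/
theorem eq_of_not_covered [Finite S] {e g : S} (hg : g * g = g) (h : nle e g)
    (hcov : ¬ ∃ h : S, h * h = h ∧ nlt e h ∧
      ¬ ∃ h' : S, h' * h' = h' ∧ nlt e h' ∧ nlt h' h) : e = g := by
  by_contra hne
  let r : S → S → Prop := fun a b => a * a = a ∧ b * b = b ∧ a * b = a ∧ a ≠ b
  have : IsTrans S r := ⟨by
    rintro a b c ⟨ha, hb, hab, hne⟩ ⟨-, hc, hbc, -⟩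
    refine ⟨ha, hc, by rw [← hab, mul_assoc, hbc], ?_⟩
    rintro rfl
    exact hne (idem_antisymm ha hb hab hbc)⟩
  have : Std.Irrefl r := ⟨fun a h => h.2.2.2 rfl⟩
  obtain ⟨c, ⟨hc, hec⟩, hmin⟩ := (Finite.wellFounded_of_trans_of_irrefl r).has_min
    {c | c * c = c ∧ nlt e c} ⟨g, hg, h, hne⟩
  refine hcov ⟨c, hc, hec, ?_⟩
  rintro ⟨d, hd, hed, hdc⟩
  exact hmin d ⟨hd, hed⟩ ⟨hd, hc, mul_eq_left_of_nle hc hdc.1, hdc.2⟩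

end InverseSemigroup

/-- If s or t is not a lonely idempotent, then s*t is not a
lonely idempotent. -/
theorem mul_not_lonely
    {S : Type*} [InverseSemigroup S] [Finite S]
    (m : S) (hm : IsMinIdem m)
    (s t : S) (h : ¬ Lonely m s ∨ ¬ Lonely m t) :
    ¬ Lonely m (s * t) := by
  intro hl
  obtain ⟨he, -, hD, -, -, hcov⟩ := id hl
  have hinv := inv_eq_self_of_idem he
  have hs : s = s * t := by
    have hg : s * t = s * inv s := eq_of_not_covered (mul_inv_idem s)
      ⟨s * t, he, (idem_mul_eq_left he (by rw [← mul_assoc, mul_inv_mul])).symm⟩ hcov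
    exact hD s ⟨s * t, rfl, by rw [hinv, he, hg]⟩
  have ht : t = s * t := by
    have hg : s * t = inv t * t := eq_of_not_covered (inv_mul_idem t)
      ⟨s * t, he, by rw [mul_assoc, ← mul_assoc t, mul_inv_mul]⟩ hcov
    exact hD t ⟨t, by rw [hinv, he, hg], rfl⟩
  rcases h with h | h
  · exact h (by rwa [← hs] at hl)
  · exact h (by rwa [← ht] at hl)
end

section
/- Let S be a finite inverse semigroup and let m be the minimum element of (E(S), ≤). If x ∈ S is a lonely idempotent and y ∈ S is not a lonely idempotent, then m·y = x·y and y·m = y·x. -/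
open InverseSemigroup

namespace InverseSemigroup

variable {S : Type*} [InverseSemigroup S]

/-- A product of two idempotents is idempotent. -/
theorem idem_mul_idem {e f : S} (he : e * e = e) (hf : f * f = f) :
    e * f * (e * f) = e * f := by
  have h₁ := mul_inv_mul (e * f)
  have h₂ := inv_mul_inv (e * f)
  generalize inv (e * f) = z at h₁ h₂
  have he' : ∀ a, e * (e * a) = e * a := fun a => by rw [← mul_assoc, he]
  have hf' : ∀ a, f * (f * a) = f * a := fun a => by rw [← mul_assoc, hf]
  simp only [mul_assoc] at h₁ h₂
  have h₃ : ∀ a, z * (e * (f * (z * a))) = z * a := fun a => by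
    simpa only [mul_assoc] using congrArg (· * a) h₂
  have hw : f * z * e = z := by
    rw [inv_unique (e * f) (f * z * e), inv_unique (e * f) z]
    · simpa only [mul_assoc] using h₁
    · simpa only [mul_assoc] using h₂
    · simp only [mul_assoc, he', hf', h₁]
    · simp only [mul_assoc, he', hf', h₃]
  have hz : z * z = z := by
    calc z * z = f * z * e * (f * z * e) := by rw [hw]
      _ = f * z * e := by simp only [mul_assoc, h₃]
      _ = z := hw
  have hzef : e * f = z := by
    rw [inv_unique z (e * f), inv_eq_self_of_idem hz]
    · simpa only [mul_assoc] using h₂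
    · simpa only [mul_assoc] using h₁
  rw [hzef, hz]

/-- Idempotents of an inverse semigroup commute. -/
theorem idem_comm {e f : S} (he : e * e = e) (hf : f * f = f) : e * f = f * e := by
  have hef := idem_mul_idem he hf
  have hfe := idem_mul_idem hf he
  have he' : ∀ a, e * (e * a) = e * a := fun a => by rw [← mul_assoc, he]
  have hf' : ∀ a, f * (f * a) = f * a := fun a => by rw [← mul_assoc, hf]
  rw [inv_unique (e * f) (f * e), inv_eq_self_of_idem hef]
  · simpa only [mul_assoc, he', hf'] using hef
  · simpa only [mul_assoc, he', hf'] using hfe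

theorem nle_trans {s t u : S} (hst : nle s t) (htu : nle t u) : nle s u := by
  obtain ⟨e, he, rfl⟩ := hst
  obtain ⟨f, hf, rfl⟩ := htu
  exact ⟨e * f, idem_mul_idem he hf, (mul_assoc _ _ _).symm⟩

theorem nle_antisymm {s t : S} (hst : nle s t) (hts : nle t s) : s = t := by
  obtain ⟨e, he, hs⟩ := hst
  obtain ⟨f, hf, ht⟩ := hts
  have hes : e * s = s := by rw [hs, ← mul_assoc, he]
  calc s = e * (f * s) := by rw [← ht, ← hs]
    _ = f * (e * s) := by rw [← mul_assoc, idem_comm he hf, mul_assoc]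
    _ = t := by rw [hes, ← ht]

theorem nlt_trans {s t u : S} (hst : nlt s t) (htu : nlt t u) : nlt s u :=
  ⟨nle_trans hst.1 htu.1, fun h => htu.2 (nle_antisymm htu.1 (h ▸ hst.1))⟩

theorem wellFounded_nlt [Finite S] : WellFounded (nlt : S → S → Prop) :=
  haveI : IsTrans S nlt := ⟨fun _ _ _ => nlt_trans⟩
  haveI : Std.Irrefl (nlt : S → S → Prop) := ⟨fun _ h => h.2 rfl⟩
  Finite.wellFounded_of_trans_of_irrefl nlt

namespace Lonely

variable {m x : S}

/-- In a finite inverse semigroup, a lonely idempotent is maximal among the idempotents. -/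
theorem eq_of_nle [Finite S] (hx : Lonely m x) {e : S} (he : e * e = e) (hxe : nle x e) :
    x = e := by
  by_contra hne
  obtain ⟨h, ⟨hh, hxh⟩, hmin⟩ :=
    wellFounded_nlt.has_min {h : S | h * h = h ∧ nlt x h} ⟨e, he, hxe, hne⟩
  exact hx.2.2.2.2.2 ⟨h, hh, hxh, fun ⟨h', hh', hxh', hlt⟩ => hmin h' ⟨hh', hxh'⟩ hlt⟩

/-- The meet of a lonely idempotent with any other idempotent is the minimum idempotent. -/
theorem mul_eq_min [Finite S] (hm : IsMinIdem m) (hx : Lonely m x) {e : S} (he : e * e = e)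
    (hne : x ≠ e) : x * e = m := by
  have hxe := idem_mul_idem hx.1 he
  by_contra hne'
  refine hx.2.2.2.2.1 ⟨x * e, hxe, ⟨hm.2 _ hxe, Ne.symm hne'⟩, ⟨e, he, idem_comm hx.1 he⟩, ?_⟩
  exact fun h => hne (hx.eq_of_nle he ⟨x, hx.1, h.symm⟩)

theorem eq_of_mul_inv_eq (hx : Lonely m x) {y : S} (h : y * inv y = x) : y = x :=
  hx.2.2.1 y ⟨x, rfl, by rw [inv_eq_self_of_idem hx.1, hx.1, h]⟩

theorem eq_of_inv_mul_eq (hx : Lonely m x) {y : S} (h : inv y * y = x) : y = x :=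
  hx.2.2.1 y ⟨y, by rw [inv_eq_self_of_idem hx.1, hx.1, h], rfl⟩

end Lonely

end InverseSemigroup

/-- If x is a lonely idempotent and y is not a lonely idempotent,
then m*y = x*y and y*m = y*x, where m is the minimum idempotent. -/
theorem lonely_mul_not_lonely
    {S : Type*} [InverseSemigroup S] [Finite S]
    (m : S) (hm : IsMinIdem m)
    (x y : S) (hx : Lonely m x) (hy : ¬ Lonely m y) :
    m * y = x * y ∧ y * m = y * x := by
  have hne : y ≠ x := fun h => hy (h ▸ hx)
  constructor
  · rw [← hx.mul_eq_min hm (mul_inv_idem y) fun h => hne (hx.eq_of_mul_inv_eq h.symm),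
      mul_assoc, mul_inv_mul]
  · rw [← hx.mul_eq_min hm (inv_mul_idem y) fun h => hne (hx.eq_of_inv_mul_eq h.symm),
      idem_comm hx.1 (inv_mul_idem y), ← mul_assoc, ← mul_assoc, mul_inv_mul]
end
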